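/- For the weakly asymmetric random walk with parameter c > 0 whose starting point X_0 is chosen uniformly at random from T_N = {0,1,…,N}, the scaled range R_N/N converges in distribution to the uniform distribution on [0,1]: for every β ∈ (0,1), lim_{N→∞} P(R_N ≥ βN) = 1 − β. -/

import Mathlib

open Filter Topology

/-- Position of the nearest-neighbor walk after the steps `w` (`true` = one step right,
`false` = one step left), started from `x`. -/
def walkPos (x : ℤ) (w : List Bool) : ℤ :=
  x + (w.count true : ℤ) - (w.count false : ℤ)

/-- `w` is the step sequence of a trajectory on `{0, 1, …, N}` started at `x` and run
exactly until the exit time `τ_N = T_0 ∧ T_N`: all positions strictly before the last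
step lie strictly inside `(0, N)`, and the final position is `0` or `N`. -/
def IsExitPath (N : ℕ) (x : ℤ) (w : List Bool) : Prop :=
  (∀ k < w.length, 0 < walkPos x (w.take k) ∧ walkPos x (w.take k) < (N : ℤ)) ∧
    (walkPos x w = 0 ∨ walkPos x w = (N : ℤ))

/-- Probability weight of the step sequence `w` when each step goes right with
probability `p` and left with probability `1 - p`, independently. -/
noncomputable def wt (p : ℝ) (w : List Bool) : ℝ :=
  p ^ w.count true * (1 - p) ^ w.count false

/-- `prob N p x S` is the probability, for the walk on `{0, …, N}` with right-step
probability `p` started at `x` and stopped at the exit time `τ_N`, that its stopped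
trajectory (recorded as the step sequence up to time `τ_N`) satisfies `S`. -/
noncomputable def prob (N : ℕ) (p : ℝ) (x : ℤ) (S : List Bool → Prop) : ℝ :=
  ∑' w : List Bool, Set.indicator {w | IsExitPath N x w ∧ S w} (wt p) w

/-- Expectation of `f` of the stopped trajectory for the walk started at `x`. -/
noncomputable def expect (N : ℕ) (p : ℝ) (x : ℤ) (f : List Bool → ℝ) : ℝ :=
  ∑' w : List Bool, Set.indicator {w | IsExitPath N x w} (fun w => wt p w * f w) w

/-- Probability for the walk whose starting point is uniformly distributed on
`{0, 1, …, N}`; the event `S` may depend on the starting point. -/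
noncomputable def probUniform (N : ℕ) (p : ℝ) (S : ℤ → List Bool → Prop) : ℝ :=
  (∑ x ∈ Finset.range (N + 1), prob N p (x : ℤ) (S (x : ℤ))) / (N + 1)

/-- The set of sites visited by the stopped walk up to time `τ_N` (time `0` included). -/
def rangeSet (x : ℤ) (w : List Bool) : Finset ℤ :=
  (Finset.range (w.length + 1)).image fun k => walkPos x (w.take k)

/-- The range `R_N`: the number of distinct sites visited up to the exit time. -/
def rangeCount (x : ℤ) (w : List Bool) : ℕ := (rangeSet x w).card

/-- The local time `G(y) = Σ_{k=0}^{τ_N} 1_{X_k = y}` of the stopped trajectory `w`. -/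
def localTime (x y : ℤ) (w : List Bool) : ℕ :=
  ((Finset.range (w.length + 1)).filter fun k => walkPos x (w.take k) = y).card

/-- The event `T_y < τ_N`: the walk started at `x` visits `y` at some time
`k ≥ 1` strictly before the end of the stopped trajectory `w`. -/
def hitsBefore (x y : ℤ) (w : List Bool) : Prop :=
  ∃ k, 1 ≤ k ∧ k < w.length ∧ walkPos x (w.take k) = y

section RangeHelpers

theorem walkPos_nil' (x : ℤ) : walkPos x [] = x := by simp [walkPos]

theorem walkPos_true (x : ℤ) (w : List Bool) : walkPos x (true :: w) = walkPos (x + 1) w := by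
  simp [walkPos]; ring

theorem walkPos_false (x : ℤ) (w : List Bool) : walkPos x (false :: w) = walkPos (x - 1) w := by
  simp [walkPos]; ring

theorem isExitPath_nil (N : ℕ) (x : ℤ) : IsExitPath N x [] ↔ x = 0 ∨ x = (N : ℤ) := by
  simp [IsExitPath, walkPos_nil']

theorem isExitPath_cons (N : ℕ) (x y : ℤ) (b : Bool)
    (h : ∀ w, walkPos x (b :: w) = walkPos y w) (w : List Bool) :
    IsExitPath N x (b :: w) ↔ (0 < x ∧ x < (N : ℤ)) ∧ IsExitPath N y w := by
  unfold IsExitPath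
  rw [h]
  constructor
  · rintro ⟨h1, h2⟩
    refine ⟨?_, ?_, h2⟩
    · simpa [walkPos_nil'] using h1 0 (by simp)
    · intro k hk
      have := h1 (k + 1) (by simpa using hk)
      simpa [List.take_succ_cons, h] using this
  · rintro ⟨h0, h1, h2⟩
    refine ⟨?_, h2⟩
    intro k hk
    cases k with
    | zero => simpa [walkPos_nil'] using h0
    | succ k =>
      have := h1 k (by simpa using hk)
      simpa [List.take_succ_cons, h] using this

theorem isExitPath_true (N : ℕ) (x : ℤ) (w : List Bool) :
    IsExitPath N x (true :: w) ↔ (0 < x ∧ x < (N : ℤ)) ∧ IsExitPath N (x + 1) w :=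
  isExitPath_cons N x _ _ (walkPos_true x) w

theorem isExitPath_false (N : ℕ) (x : ℤ) (w : List Bool) :
    IsExitPath N x (false :: w) ↔ (0 < x ∧ x < (N : ℤ)) ∧ IsExitPath N (x - 1) w :=
  isExitPath_cons N x _ _ (walkPos_false x) w

theorem wt_true (p : ℝ) (w : List Bool) : wt p (true :: w) = p * wt p w := by
  simp [wt, pow_succ]; ring

theorem wt_false (p : ℝ) (w : List Bool) : wt p (false :: w) = (1 - p) * wt p w := by
  simp [wt, pow_succ]; ring

theorem wt_nonneg {p : ℝ} (h0 : 0 < p) (h1 : p < 1) (w : List Bool) : 0 ≤ wt p w := by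
  have : 0 < 1 - p := by linarith
  unfold wt; positivity

theorem rangeSet_nil (x : ℤ) : rangeSet x [] = {x} := by
  simp [rangeSet, walkPos_nil']

theorem rangeSet_cons (x y : ℤ) (b : Bool)
    (h : ∀ w, walkPos x (b :: w) = walkPos y w) (w : List Bool) :
    rangeSet x (b :: w) = insert x (rangeSet y w) := by
  ext z
  simp only [rangeSet, Finset.mem_image, Finset.mem_insert, Finset.mem_range, List.length_cons]
  constructor
  · rintro ⟨k, hk, rfl⟩
    cases k with
    | zero => left; simp [walkPos_nil']
    | succ k => right; exact ⟨k, by omega, by simp [h]⟩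
  · rintro (rfl | ⟨k, hk, rfl⟩)
    · exact ⟨0, by omega, by simp [walkPos_nil']⟩
    · exact ⟨k + 1, by omega, by simp [h]⟩

theorem rangeSet_true (x : ℤ) (w : List Bool) :
    rangeSet x (true :: w) = insert x (rangeSet (x + 1) w) :=
  rangeSet_cons x _ _ (walkPos_true x) w

theorem rangeSet_false (x : ℤ) (w : List Bool) :
    rangeSet x (false :: w) = insert x (rangeSet (x - 1) w) :=
  rangeSet_cons x _ _ (walkPos_false x) w

theorem start_mem_rangeSet (x : ℤ) (w : List Bool) : x ∈ rangeSet x w := by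
  cases w with
  | nil => simp [rangeSet_nil]
  | cons b w => cases b <;> simp [rangeSet_true, rangeSet_false]

theorem end_mem_rangeSet (x : ℤ) (w : List Bool) : walkPos x w ∈ rangeSet x w := by
  simp only [rangeSet, Finset.mem_image, Finset.mem_range]
  exact ⟨w.length, by omega, by simp⟩

theorem rangeSet_eq_Icc (w : List Bool) : ∀ x : ℤ, ∃ a b : ℤ, a ≤ x ∧ x ≤ b ∧
    rangeSet x w = Finset.Icc a b := by
  induction w with
  | nil => intro x; exact ⟨x, x, le_rfl, le_rfl, by simp [rangeSet_nil]⟩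
  | cons s w ih =>
    intro x
    cases s with
    | true =>
      obtain ⟨a, b, ha, hb, hab⟩ := ih (x + 1)
      refine ⟨min a x, b, min_le_right _ _, by omega, ?_⟩
      rw [rangeSet_true, hab]
      ext z; simp only [Finset.mem_insert, Finset.mem_Icc]; omega
    | false =>
      obtain ⟨a, b, ha, hb, hab⟩ := ih (x - 1)
      refine ⟨a, max b x, by omega, le_max_right _ _, ?_⟩
      rw [rangeSet_false, hab]
      ext z; simp only [Finset.mem_insert, Finset.mem_Icc]; omega

theorem isExitPath_rangeSet (N : ℕ) (w : List Bool) (x : ℤ) (h : IsExitPath N x w) :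
    ∀ z ∈ rangeSet x w, 0 ≤ z ∧ z ≤ N := by
  intro z hz
  simp only [rangeSet, Finset.mem_image, Finset.mem_range] at hz
  obtain ⟨k, hk, rfl⟩ := hz
  rcases Nat.lt_or_ge k w.length with h1 | h1
  · have := h.1 k h1; omega
  · rw [List.take_of_length_le h1]
    have := h.2; omega

theorem rangeCount_iff (N b : ℕ) (w : List Bool) (x : ℤ) (h : IsExitPath N x w) :
    b + 1 ≤ rangeCount x w ↔
      (walkPos x w = 0 ∧ (b : ℤ) ∈ rangeSet x w) ∨
        (walkPos x w = N ∧ (N : ℤ) - b ∈ rangeSet x w) := by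
  have h1 := isExitPath_rangeSet N w x h
  have h2 := end_mem_rangeSet x w
  obtain ⟨l, r, hl, hr, hlr⟩ := rangeSet_eq_Icc w x
  have h3 := h1 l (by rw [hlr]; simp; omega)
  have h4 := h1 r (by rw [hlr]; simp; omega)
  unfold rangeCount
  rw [hlr] at h2 ⊢
  simp only [Int.card_Icc, Finset.mem_Icc] at h2 ⊢
  have := h.2
  omega

/-- Lists of length at most `n`. -/
def listsUpTo : ℕ → Finset (List Bool)
  | 0 => {[]}
  | n + 1 => insert [] ((listsUpTo n).image (List.cons true) ∪ (listsUpTo n).image (List.cons false))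

theorem mem_listsUpTo (n : ℕ) : ∀ w : List Bool, w.length ≤ n → w ∈ listsUpTo n := by
  induction n with
  | zero => intro w hw; simp at hw; simp [listsUpTo, hw]
  | succ n ih =>
    intro w hw
    cases w with
    | nil => simp [listsUpTo]
    | cons b w =>
      have := ih w (by simpa using hw)
      cases b <;> simp [listsUpTo, this]

theorem sum_listsUpTo (f : List Bool → ℝ) (n : ℕ) :
    ∑ w ∈ listsUpTo (n + 1), f w =
      f [] + (∑ w ∈ listsUpTo n, f (true :: w) + ∑ w ∈ listsUpTo n, f (false :: w)) := by
  rw [listsUpTo, Finset.sum_insert (by simp), Finset.sum_union, Finset.sum_image, Finset.sum_image]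
  · intro a _ b _ h; simpa using h
  · intro a _ b _ h; simpa using h
  · rw [Finset.disjoint_left]
    simp

theorem ind_true (N : ℕ) (p : ℝ) (x : ℤ) (S T : List Bool → Prop) (hx : 0 < x ∧ x < (N : ℤ))
    (hS : ∀ w, S (true :: w) ↔ T w) (w : List Bool) :
    Set.indicator {w | IsExitPath N x w ∧ S w} (wt p) (true :: w) =
      p * Set.indicator {w | IsExitPath N (x + 1) w ∧ T w} (wt p) w := by
  classical
  simp only [Set.indicator_apply, Set.mem_ofPred_eq, isExitPath_true, hS, wt_true, hx, true_and]
  split_ifs <;> simp_all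

theorem ind_false (N : ℕ) (p : ℝ) (x : ℤ) (S T : List Bool → Prop) (hx : 0 < x ∧ x < (N : ℤ))
    (hS : ∀ w, S (false :: w) ↔ T w) (w : List Bool) :
    Set.indicator {w | IsExitPath N x w ∧ S w} (wt p) (false :: w) =
      (1 - p) * Set.indicator {w | IsExitPath N (x - 1) w ∧ T w} (wt p) w := by
  classical
  simp only [Set.indicator_apply, Set.mem_ofPred_eq, isExitPath_false, hS, wt_false, hx, true_and]
  split_ifs <;> simp_all

theorem ind_nil (N : ℕ) (p : ℝ) (x : ℤ) (S : List Bool → Prop) (hx : 0 < x ∧ x < (N : ℤ)) :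
    Set.indicator {w | IsExitPath N x w ∧ S w} (wt p) [] = 0 := by
  apply Set.indicator_of_notMem
  simp only [Set.mem_ofPred_eq, isExitPath_nil]
  omega

theorem ind_cons_of_boundary (N : ℕ) (p : ℝ) (x : ℤ) (S : List Bool → Prop)
    (hx : ¬ (0 < x ∧ x < (N : ℤ))) (b : Bool) (w : List Bool) :
    Set.indicator {w | IsExitPath N x w ∧ S w} (wt p) (b :: w) = 0 := by
  apply Set.indicator_of_notMem
  simp only [Set.mem_ofPred_eq]
  cases b <;> simp only [isExitPath_true, isExitPath_false] <;> tauto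

theorem ind_nil_le (N : ℕ) (p : ℝ) (x : ℤ) (S : List Bool → Prop) :
    Set.indicator {w | IsExitPath N x w ∧ S w} (wt p) [] ≤ 1 := by
  classical
  rw [Set.indicator_apply]; split_ifs <;> simp [wt]

theorem sum_le_one (N : ℕ) (p : ℝ) (h0 : 0 < p) (h1 : p < 1) (n : ℕ) : ∀ x : ℤ,
    ∑ w ∈ listsUpTo n, Set.indicator {w | IsExitPath N x w ∧ True} (wt p) w ≤ 1 := by
  induction n with
  | zero => intro x; simpa only [listsUpTo, Finset.sum_singleton] using ind_nil_le N p x _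
  | succ n ih =>
    intro x
    rw [sum_listsUpTo]
    by_cases hx : 0 < x ∧ x < (N : ℤ)
    · rw [ind_nil N p x _ hx]
      simp only [ind_true N p x (fun _ => True) (fun _ => True) hx (fun _ => Iff.rfl),
        ind_false N p x (fun _ => True) (fun _ => True) hx (fun _ => Iff.rfl), ← Finset.mul_sum]
      nlinarith [ih (x + 1), ih (x - 1)]
    · simp only [ind_cons_of_boundary N p x (fun _ => True) hx, Finset.sum_const_zero, add_zero]
      exact ind_nil_le N p x _

theorem summable_ind (N : ℕ) (p : ℝ) (h0 : 0 < p) (h1 : p < 1) (x : ℤ) (S : List Bool → Prop) :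
    Summable (Set.indicator {w | IsExitPath N x w ∧ S w} (wt p)) := by
  have hT : Summable (Set.indicator {w | IsExitPath N x w ∧ True} (wt p)) := by
    have hnn : 0 ≤ Set.indicator {w | IsExitPath N x w ∧ True} (wt p) :=
      fun w => Set.indicator_nonneg (fun w _ => wt_nonneg h0 h1 w) w
    refine summable_of_sum_le (c := 1) hnn ?_
    intro u
    refine le_trans ?_ (sum_le_one N p h0 h1 (u.sup List.length) x)
    apply Finset.sum_le_sum_of_subset_of_nonneg
    · intro w hw
      exact mem_listsUpTo _ w (Finset.le_sup hw)
    · intro w _ _; exact hnn w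
  refine Summable.of_nonneg_of_le (fun w => Set.indicator_nonneg (fun w _ => wt_nonneg h0 h1 w) w)
    (fun w => ?_) hT
  have hsub : {w | IsExitPath N x w ∧ S w} ⊆ {w | IsExitPath N x w ∧ True} :=
    fun w hw => ⟨hw.1, trivial⟩
  exact Set.indicator_le_indicator_of_subset hsub (fun w => wt_nonneg h0 h1 w) w

/-- Decomposition of lists by the first letter. -/
def listEquivAux : Unit ⊕ (List Bool ⊕ List Bool) ≃ List Bool where
  toFun
    | .inl _ => []
    | .inr (.inl w) => true :: w
    | .inr (.inr w) => false :: w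
  invFun
    | [] => .inl ()
    | true :: w => .inr (.inl w)
    | false :: w => .inr (.inr w)
  left_inv := by rintro (_ | _ | _) <;> rfl
  right_inv := by
    intro w
    match w with
    | [] => rfl
    | true :: _ => rfl
    | false :: _ => rfl

theorem tsum_list (f : List Bool → ℝ) (hf : Summable f) :
    ∑' w, f w = f [] + (∑' w, f (true :: w) + ∑' w, f (false :: w)) := by
  have ht : Summable (fun w => f (true :: w)) :=
    hf.comp_injective (fun a b h => by simpa using h)
  have hF : Summable (fun w => f (false :: w)) :=
    hf.comp_injective (fun a b h => by simpa using h)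
  have h1 : HasSum (f ∘ listEquivAux) (f [] + (∑' w, f (true :: w) + ∑' w, f (false :: w))) := by
    refine HasSum.sum ?_ (HasSum.sum ht.hasSum hF.hasSum)
    exact hasSum_unique _
  exact ((listEquivAux.hasSum_iff).1 h1).tsum_eq

theorem prob_step (N : ℕ) (p : ℝ) (h0 : 0 < p) (h1 : p < 1) (x : ℤ) (S : ℤ → List Bool → Prop)
    (hx : 0 < x ∧ x < (N : ℤ)) (hT : ∀ w, S x (true :: w) ↔ S (x + 1) w)
    (hF : ∀ w, S x (false :: w) ↔ S (x - 1) w) :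
    prob N p x (S x) = p * prob N p (x + 1) (S (x + 1)) + (1 - p) * prob N p (x - 1) (S (x - 1)) := by
  unfold prob
  rw [tsum_list _ (summable_ind N p h0 h1 x _), ind_nil N p x _ hx, zero_add]
  simp only [ind_true N p x (S x) (S (x + 1)) hx hT, ind_false N p x (S x) (S (x - 1)) hx hF,
    tsum_mul_left]

theorem prob_boundary (N : ℕ) (p : ℝ) (h0 : 0 < p) (h1 : p < 1) (x : ℤ) (S : List Bool → Prop)
    (hx : x = 0 ∨ x = (N : ℤ)) [Decidable (S [])] :
    prob N p x S = if S [] then 1 else 0 := by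
  classical
  unfold prob
  have hx' : ¬ (0 < x ∧ x < (N : ℤ)) := by omega
  rw [tsum_list _ (summable_ind N p h0 h1 x _)]
  simp only [ind_cons_of_boundary N p x S hx', tsum_zero, add_zero]
  simp [Set.indicator_apply, isExitPath_nil, hx, wt]

theorem prob_congr (N : ℕ) (p : ℝ) (x : ℤ) (S T : List Bool → Prop)
    (h : ∀ w, IsExitPath N x w → (S w ↔ T w)) : prob N p x S = prob N p x T := by
  unfold prob
  congr 1
  have : {w | IsExitPath N x w ∧ S w} = {w | IsExitPath N x w ∧ T w} := by
    ext w; simp only [Set.mem_ofPred_eq]; exact and_congr_right (h w)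
  rw [this]

theorem prob_or (N : ℕ) (p : ℝ) (h0 : 0 < p) (h1 : p < 1) (x : ℤ) (S T : List Bool → Prop)
    (h : ∀ w, S w → ¬ T w) :
    prob N p x (fun w => S w ∨ T w) = prob N p x S + prob N p x T := by
  classical
  unfold prob
  rw [← (summable_ind N p h0 h1 x S).tsum_add (summable_ind N p h0 h1 x T)]
  congr 1
  ext w
  simp only [Set.indicator_apply, Set.mem_ofPred_eq]
  have := h w
  by_cases a : IsExitPath N x w <;> by_cases b : S w <;> by_cases c : T w <;> simp_all

/-- Uniqueness for the discrete Dirichlet problem. -/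
theorem dirichlet_zero (p : ℝ) (h0 : 0 < p) (h1 : p < 1) (d : ℕ → ℝ) (n : ℕ)
    (hd : ∀ k, k + 1 < n → d (k + 1) = p * d (k + 2) + (1 - p) * d k)
    (hd0 : d 0 = 0) (hdn : d n = 0) : ∀ k ≤ n, d k = 0 := by
  have hq : 0 < (1 - p) / p := div_pos (by linarith) h0
  have key : ∀ k, k + 1 ≤ n → d k = d 1 * ∑ i ∈ Finset.range k, ((1 - p) / p) ^ i ∧
      d (k + 1) = d 1 * ∑ i ∈ Finset.range (k + 1), ((1 - p) / p) ^ i := by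
    intro k
    induction k with
    | zero => intro _; simp [hd0]
    | succ k ih =>
      intro hk
      obtain ⟨a, b⟩ := ih (by omega)
      refine ⟨b, ?_⟩
      have e := hd k (by omega)
      have e2 : d (k + 2) = d (k + 1) + (1 - p) / p * (d (k + 1) - d k) := by
        field_simp; linarith
      rw [show k + 1 + 1 = k + 2 from rfl, e2, a, b, Finset.sum_range_succ _ (k + 1),
        Finset.sum_range_succ _ k]
      ring
  intro k hk
  rcases Nat.eq_zero_or_pos n with rfl | hn
  · obtain rfl : k = 0 := by omega
    exact hd0
  have hkn := (key (n - 1) (by omega)).2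
  rw [Nat.sub_add_cancel hn, hdn] at hkn
  have hpos : 0 < ∑ i ∈ Finset.range n, ((1 - p) / p) ^ i :=
    Finset.sum_pos (fun i _ => by positivity) ⟨0, by simpa using hn⟩
  have hd1 : d 1 = 0 := by
    rcases mul_eq_zero.1 hkn.symm with h | h
    · exact h
    · exact absurd h hpos.ne'
  rcases Nat.eq_zero_or_pos k with rfl | hk0
  · exact hd0
  · have := (key (k - 1) (by omega)).2
    rw [Nat.sub_add_cancel hk0, hd1, zero_mul] at this
    exact this

/-- A harmonic function agrees with `A + B ρ ^ k` as soon as the boundary values do. -/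
theorem harmonic_eq (p : ℝ) (h0 : 0 < p) (h1 : p < 1) (f : ℕ → ℝ) (l r : ℕ) (A B : ℝ)
    (hf : ∀ k, l < k + 1 → k + 1 < r → f (k + 1) = p * f (k + 2) + (1 - p) * f k)
    (hl : f l = A + B * ((1 - p) / p) ^ l) (hr : f r = A + B * ((1 - p) / p) ^ r) :
    ∀ k, l ≤ k → k ≤ r → f k = A + B * ((1 - p) / p) ^ k := by
  intro k hlk hkr
  have := dirichlet_zero p h0 h1 (fun j => f (l + j) - (A + B * ((1 - p) / p) ^ (l + j))) (r - l)
    (by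
      intro j hj
      have := hf (l + j) (by omega) (by omega)
      simp only [← add_assoc]
      rw [this]
      have hr : p * ((1 - p) / p) = 1 - p := by field_simp
      generalize (1 - p) / p = ρ at *
      have e : p * ρ ^ (l + j + 2) + (1 - p) * ρ ^ (l + j) = ρ ^ (l + j + 1) := by
        rw [pow_succ, pow_succ]
        linear_combination (ρ ^ (l + j) * ρ - ρ ^ (l + j)) * hr
      linear_combination B * e)
    (by simp [hl]) (by simp [Nat.add_sub_cancel' (hlk.trans hkr), hr]) (k - l) (by omega)
  simp only [Nat.add_sub_cancel' hlk] at this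
  linarith

/-- Ends at `e`. -/
noncomputable def hEnd (N : ℕ) (p : ℝ) (e : ℤ) (x : ℕ) : ℝ :=
  prob N p (x : ℤ) (fun w => walkPos x w = e)

/-- Ends at `e` and visits `b`. -/
noncomputable def uEnd (N : ℕ) (p : ℝ) (e b : ℤ) (x : ℕ) : ℝ :=
  prob N p (x : ℤ) (fun w => walkPos x w = e ∧ b ∈ rangeSet x w)

theorem hEnd_step (N : ℕ) (p : ℝ) (h0 : 0 < p) (h1 : p < 1) (e : ℤ) (k : ℕ) (hk : k + 1 < N) :
    hEnd N p e (k + 1) = p * hEnd N p e (k + 2) + (1 - p) * hEnd N p e k := by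
  have := prob_step N p h0 h1 ((k : ℤ) + 1) (fun x w => walkPos x w = e) (by omega)
    (fun w => by rw [walkPos_true]) (fun w => by rw [walkPos_false])
  simp only [add_assoc, add_sub_cancel_right] at this
  simpa [hEnd, one_add_one_eq_two] using this

theorem uEnd_step (N : ℕ) (p : ℝ) (h0 : 0 < p) (h1 : p < 1) (e b : ℤ) (k : ℕ) (hk : k + 1 < N)
    (hb : b ≠ (k : ℤ) + 1) :
    uEnd N p e b (k + 1) = p * uEnd N p e b (k + 2) + (1 - p) * uEnd N p e b k := by
  have := prob_step N p h0 h1 ((k : ℤ) + 1)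
    (fun x w => walkPos x w = e ∧ b ∈ rangeSet x w) (by omega)
    (fun w => by rw [walkPos_true, rangeSet_true, Finset.mem_insert, or_iff_right hb])
    (fun w => by rw [walkPos_false, rangeSet_false, Finset.mem_insert, or_iff_right hb])
  simp only [add_assoc, add_sub_cancel_right] at this
  simpa [uEnd, one_add_one_eq_two] using this

theorem hEnd_boundary (N : ℕ) (p : ℝ) (h0 : 0 < p) (h1 : p < 1) (e : ℤ) (x : ℕ)
    (hx : x = 0 ∨ x = N) : hEnd N p e x = if (x : ℤ) = e then 1 else 0 := by
  classical
  unfold hEnd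
  rw [prob_boundary N p h0 h1 _ _ (by omega)]
  simp [walkPos_nil']

theorem uEnd_boundary (N : ℕ) (p : ℝ) (h0 : 0 < p) (h1 : p < 1) (e b : ℤ) (x : ℕ)
    (hx : x = 0 ∨ x = N) : uEnd N p e b x = if (x : ℤ) = e ∧ b = x then 1 else 0 := by
  classical
  unfold uEnd
  rw [prob_boundary N p h0 h1 _ _ (by omega)]
  simp [walkPos_nil', rangeSet_nil]

theorem uEnd_self (N : ℕ) (p : ℝ) (e : ℤ) (x : ℕ) : uEnd N p e x x = hEnd N p e x := by
  unfold uEnd hEnd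
  apply prob_congr
  intro w _
  simp [start_mem_rangeSet]

theorem hEnd_zero_eq (N : ℕ) (hN : 0 < N) (p ρ : ℝ) (h0 : 0 < p) (h1 : p < 1)
    (hρ : ρ = (1 - p) / p) (hρN : 1 - ρ ^ N ≠ 0) (k : ℕ) (hk : k ≤ N) :
    hEnd N p 0 k = (ρ ^ k - ρ ^ N) / (1 - ρ ^ N) := by
  subst hρ
  have := harmonic_eq p h0 h1 (hEnd N p 0) 0 N (-((1 - p) / p) ^ N / (1 - ((1 - p) / p) ^ N))
    (1 / (1 - ((1 - p) / p) ^ N)) (fun k _ hk => hEnd_step N p h0 h1 _ k hk)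
    (by rw [hEnd_boundary N p h0 h1 _ _ (Or.inl rfl)]; simp; rw [← one_div, ← add_div, eq_comm]
        convert div_self hρN using 2; ring)
    (by rw [hEnd_boundary N p h0 h1 _ _ (Or.inr rfl), if_neg (by omega)]; ring)
    k (Nat.zero_le _) hk
  rw [this]; ring

theorem hEnd_N_eq (N : ℕ) (hN : 0 < N) (p ρ : ℝ) (h0 : 0 < p) (h1 : p < 1)
    (hρ : ρ = (1 - p) / p) (hρN : 1 - ρ ^ N ≠ 0) (k : ℕ) (hk : k ≤ N) :
    hEnd N p N k = (1 - ρ ^ k) / (1 - ρ ^ N) := by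
  subst hρ
  have := harmonic_eq p h0 h1 (hEnd N p N) 0 N (1 / (1 - ((1 - p) / p) ^ N))
    (-1 / (1 - ((1 - p) / p) ^ N)) (fun k _ hk => hEnd_step N p h0 h1 _ k hk)
    (by rw [hEnd_boundary N p h0 h1 _ _ (Or.inl rfl), if_neg (by omega)]; ring)
    (by rw [hEnd_boundary N p h0 h1 _ _ (Or.inr rfl), if_pos rfl]
        generalize (1 - p) / p = r at *
        field_simp; ring)
    k (Nat.zero_le _) hk
  rw [this]; ring

theorem uEnd_zero_low (b m : ℕ) (hb : 0 < b) (p ρ : ℝ) (h0 : 0 < p) (h1 : p < 1)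
    (hρ : ρ = (1 - p) / p) (hρb : 1 - ρ ^ b ≠ 0) (k : ℕ) (hk : k ≤ b) :
    uEnd (b + m) p 0 b k = hEnd (b + m) p 0 b / (1 - ρ ^ b) * (1 - ρ ^ k) := by
  subst hρ
  have := harmonic_eq p h0 h1 (uEnd (b + m) p 0 b) 0 b
    (hEnd (b + m) p 0 b / (1 - ((1 - p) / p) ^ b)) (-(hEnd (b + m) p 0 b / (1 - ((1 - p) / p) ^ b)))
    (fun k _ hk => uEnd_step _ p h0 h1 _ _ k (by omega) (by omega))
    (by rw [uEnd_boundary _ p h0 h1 _ _ _ (Or.inl rfl), if_neg (by omega)]; ring)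
    (by rw [uEnd_self]; field_simp; ring)
    k (Nat.zero_le _) hk
  rw [this]; ring

theorem uEnd_zero_high (b m : ℕ) (hb : 0 < b) (p ρ : ℝ) (h0 : 0 < p) (h1 : p < 1)
    (hρ : ρ = (1 - p) / p) (hρN : 1 - ρ ^ (b + m) ≠ 0) (k : ℕ) (hk : b ≤ k) (hk' : k ≤ b + m) :
    uEnd (b + m) p 0 b k = (ρ ^ k - ρ ^ (b + m)) / (1 - ρ ^ (b + m)) := by
  have hh := hEnd_zero_eq (b + m) (by omega) p ρ h0 h1 hρ hρN b (by omega)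
  subst hρ
  have := harmonic_eq p h0 h1 (uEnd (b + m) p 0 b) b (b + m)
    (-((1 - p) / p) ^ (b + m) / (1 - ((1 - p) / p) ^ (b + m)))
    (1 / (1 - ((1 - p) / p) ^ (b + m)))
    (fun k _ hk => uEnd_step _ p h0 h1 _ _ k (by omega) (by omega))
    (by rw [uEnd_self, hh]; ring)
    (by rw [uEnd_boundary _ p h0 h1 _ _ _ (Or.inr rfl), if_neg (by omega)]; ring)
    k hk hk'
  rw [this]; ring

theorem uEnd_N_low (b m : ℕ) (hb : 0 < b) (p ρ : ℝ) (h0 : 0 < p) (h1 : p < 1)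
    (hρ : ρ = (1 - p) / p) (hρN : 1 - ρ ^ (b + m) ≠ 0) (k : ℕ) (hk : k ≤ m) :
    uEnd (b + m) p (b + m : ℕ) m k = (1 - ρ ^ k) / (1 - ρ ^ (b + m)) := by
  have hh := hEnd_N_eq (b + m) (by omega) p ρ h0 h1 hρ hρN m (by omega)
  subst hρ
  have := harmonic_eq p h0 h1 (uEnd (b + m) p (b + m : ℕ) m) 0 m
    (1 / (1 - ((1 - p) / p) ^ (b + m))) (-1 / (1 - ((1 - p) / p) ^ (b + m)))
    (fun k _ hk => uEnd_step _ p h0 h1 _ _ k (by omega) (by omega))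
    (by rw [uEnd_boundary _ p h0 h1 _ _ _ (Or.inl rfl), if_neg (by omega)]; ring)
    (by rw [uEnd_self, hh]; ring)
    k (Nat.zero_le _) hk
  rw [this]; ring

theorem uEnd_N_high (b m : ℕ) (hb : 0 < b) (p ρ : ℝ) (h0 : 0 < p) (h1 : p < 1)
    (hρ : ρ = (1 - p) / p) (hρb : 1 - ρ ^ b ≠ 0) (k : ℕ) (hk : k ≤ b) :
    uEnd (b + m) p (b + m : ℕ) m (m + k) =
      hEnd (b + m) p (b + m : ℕ) m / (1 - ρ ^ b) * (ρ ^ k - ρ ^ b) := by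
  have hρ0 : 0 < ρ := by rw [hρ]; exact div_pos (by linarith) h0
  have hm : ρ ^ m ≠ 0 := by positivity
  subst hρ
  have := harmonic_eq p h0 h1 (uEnd (b + m) p (b + m : ℕ) m) m (b + m)
    (-(hEnd (b + m) p (b + m : ℕ) m / (1 - ((1 - p) / p) ^ b) * ((1 - p) / p) ^ b))
    (hEnd (b + m) p (b + m : ℕ) m / (1 - ((1 - p) / p) ^ b) / ((1 - p) / p) ^ m)
    (fun k _ hk => uEnd_step _ p h0 h1 _ _ k (by omega) (by omega))
    (by
      rw [uEnd_self]
      generalize (1 - p) / p = r at *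
      field_simp; ring)
    (by
      rw [uEnd_boundary _ p h0 h1 _ _ _ (Or.inr rfl), if_neg (by omega)]
      generalize (1 - p) / p = r at *
      rw [pow_add]; field_simp; ring)
    (m + k) (by omega) (by omega)
  rw [this]
  generalize (1 - p) / p = r at *
  rw [pow_add]; field_simp; ring

theorem geom_aux (ρ : ℝ) (h : 1 - ρ ≠ 0) (n : ℕ) :
    ∑ i ∈ Finset.range n, ρ ^ i = (1 - ρ ^ n) / (1 - ρ) := by
  rw [eq_div_iff h, geom_sum_mul_neg]

theorem sum_uEnd (b m : ℕ) (hb : 0 < b) (p : ℝ) (hp : 1 / 2 < p) (h1 : p < 1) :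
    ∑ x ∈ Finset.range (b + m + 1),
      (uEnd (b + m) p 0 b x + uEnd (b + m) p (b + m : ℕ) m x) = m := by
  have h0 : 0 < p := by linarith
  obtain ⟨ρ, hρ⟩ : ∃ ρ, ρ = (1 - p) / p := ⟨_, rfl⟩
  have hρ0 : 0 < ρ := by rw [hρ]; exact div_pos (by linarith) h0
  have hρ1 : ρ < 1 := by rw [hρ, div_lt_one h0]; linarith
  have hpow : ∀ n : ℕ, 0 < n → 1 - ρ ^ n ≠ 0 := fun n hn => by
    have := pow_lt_one₀ hρ0.le hρ1 hn.ne'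
    exact (sub_pos.2 this).ne'
  have hD := hpow (b + m) (by omega)
  have hB := hpow b hb
  have hR : 1 - ρ ≠ 0 := (sub_pos.2 hρ1).ne'
  rw [Finset.sum_add_distrib]
  have s1 : ∑ x ∈ Finset.range (b + m + 1), uEnd (b + m) p 0 b x =
      ∑ x ∈ Finset.range b,
        ((ρ ^ b - ρ ^ (b + m)) / (1 - ρ ^ (b + m)) / (1 - ρ ^ b) * (1 - ρ ^ x)) +
      ∑ x ∈ Finset.range (m + 1), (ρ ^ b * ρ ^ x - ρ ^ (b + m)) / (1 - ρ ^ (b + m)) := by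
    rw [add_assoc, Finset.sum_range_add]
    congr 1
    · apply Finset.sum_congr rfl
      intro x hx
      rw [Finset.mem_range] at hx
      rw [uEnd_zero_low b m hb p ρ h0 h1 hρ hB x hx.le,
        hEnd_zero_eq (b + m) (by omega) p ρ h0 h1 hρ hD b (by omega)]
    · apply Finset.sum_congr rfl
      intro x hx
      rw [Finset.mem_range] at hx
      rw [uEnd_zero_high b m hb p ρ h0 h1 hρ hD (b + x) (by omega) (by omega), pow_add ρ b x]
  have s2 : ∑ x ∈ Finset.range (b + m + 1), uEnd (b + m) p (b + m : ℕ) m x =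
      ∑ x ∈ Finset.range (m + 1), (1 - ρ ^ x) / (1 - ρ ^ (b + m)) +
      ∑ x ∈ Finset.range b,
        ((1 - ρ ^ m) / (1 - ρ ^ (b + m)) / (1 - ρ ^ b) * (ρ * ρ ^ x - ρ ^ b)) := by
    rw [show b + m + 1 = (m + 1) + b by ring, Finset.sum_range_add]
    congr 1
    · apply Finset.sum_congr rfl
      intro x hx
      rw [Finset.mem_range] at hx
      rw [uEnd_N_low b m hb p ρ h0 h1 hρ hD x (by omega)]
    · apply Finset.sum_congr rfl
      intro x hx
      rw [Finset.mem_range] at hx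
      rw [add_assoc, uEnd_N_high b m hb p ρ h0 h1 hρ hB (1 + x) (by omega),
        hEnd_N_eq (b + m) (by omega) p ρ h0 h1 hρ hD m (by omega), pow_add ρ 1 x, pow_one]
  rw [s1, s2]
  simp only [← Finset.mul_sum, ← Finset.sum_div, Finset.sum_sub_distrib, geom_aux ρ hR,
    Finset.sum_const, Finset.card_range, nsmul_eq_mul]
  push_cast
  rw [pow_add] at hD ⊢
  rw [pow_succ]
  generalize ρ ^ b = B at *
  generalize ρ ^ m = M at *
  field_simp
  ring

theorem probUniform_eq (b m : ℕ) (hb : 0 < b) (p : ℝ) (hp : 1 / 2 < p) (h1 : p < 1) :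
    probUniform (b + m) p (fun x w => b + 1 ≤ rangeCount x w) = m / ((b + m : ℕ) + 1) := by
  have h0 : 0 < p := by linarith
  unfold probUniform
  congr 1
  rw [← sum_uEnd b m hb p hp h1]
  apply Finset.sum_congr rfl
  intro x _
  unfold uEnd
  rw [← prob_or _ p h0 h1]
  · apply prob_congr
    intro w hw
    show b + 1 ≤ rangeCount x w ↔ _
    rw [rangeCount_iff (b + m) b w x hw]
    rw [show ((b + m : ℕ) : ℤ) - b = m by push_cast; ring]
  · rintro w ⟨h, _⟩ ⟨h', _⟩
    omega

end RangeHelpers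

/-- Proposition 2 (weakly asymmetric case): for the walk with `p_N = 1/2 + c/N` started
uniformly at random on `{0, …, N}`, `R_N / N` converges in distribution to `U[0,1]`. -/
theorem range_uniform_start_weakly_asymmetric (c β : ℝ) (hc : 0 < c)
    (hβ0 : 0 < β) (hβ1 : β < 1) :
    Tendsto (fun N : ℕ => probUniform N (1/2 + c / (N : ℝ))
        fun x w => β * (N : ℝ) ≤ (rangeCount x w : ℝ))
      atTop (𝓝 (1 - β)) := by
  have hNt : Tendsto (fun N : ℕ => (N : ℝ)) atTop atTop := tendsto_natCast_atTop_atTop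
  have hev : ∀ᶠ N : ℕ in atTop, probUniform N (1/2 + c / (N : ℝ))
      (fun x w => β * (N : ℝ) ≤ (rangeCount x w : ℝ)) =
        ((N : ℝ) + 1 - ⌈β * (N : ℝ)⌉₊) / ((N : ℝ) + 1) := by
    filter_upwards [hNt.eventually_gt_atTop (2 * c), hNt.eventually_gt_atTop (1 / β),
      hNt.eventually_gt_atTop 0] with N hN1 hN2 hN0
    have hβN : 1 < β * N := by rwa [div_lt_iff₀' hβ0] at hN2
    have hr2 : 1 < ⌈β * (N : ℝ)⌉₊ := Nat.lt_ceil.2 (by exact_mod_cast hβN)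
    have hrN : ⌈β * (N : ℝ)⌉₊ ≤ N := Nat.ceil_le.2 (by nlinarith)
    have hcN : 0 < c / (N : ℝ) := div_pos hc hN0
    have hcN' : c / (N : ℝ) < 1 / 2 := by rw [div_lt_iff₀ hN0]; linarith
    obtain ⟨b, hb⟩ : ∃ b, ⌈β * (N : ℝ)⌉₊ = b + 1 := ⟨⌈β * (N : ℝ)⌉₊ - 1, by omega⟩
    obtain ⟨m, hm⟩ : ∃ m, N = b + m := ⟨N - b, by omega⟩
    have key := probUniform_eq b m (by omega) (1/2 + c / (N : ℝ)) (by linarith) (by linarith)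
    rw [← hm] at key
    have hS : (fun (x : ℤ) (w : List Bool) => β * (N : ℝ) ≤ (rangeCount x w : ℝ)) =
        fun x w => b + 1 ≤ rangeCount x w := by
      funext x w
      rw [← hb, Nat.ceil_le]
    rw [hS, key, hb]
    congr 1
    have : (N : ℝ) = b + m := by exact_mod_cast hm
    rw [this]; push_cast; ring
  refine Tendsto.congr' (EventuallyEq.symm hev) ?_
  have h1 : Tendsto (fun N : ℕ => 1 / ((N : ℝ) + 1)) atTop (𝓝 0) :=
    tendsto_one_div_add_atTop_nhds_zero_nat
  have hlow : Tendsto (fun N : ℕ => 1 - β - (1 - β) * (1 / ((N : ℝ) + 1))) atTop (𝓝 (1 - β)) := by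
    simpa using tendsto_const_nhds.sub (h1.const_mul (1 - β))
  have hhigh : Tendsto (fun N : ℕ => 1 - β + β * (1 / ((N : ℝ) + 1))) atTop (𝓝 (1 - β)) := by
    simpa using tendsto_const_nhds.add (h1.const_mul β)
  refine tendsto_of_tendsto_of_tendsto_of_le_of_le hlow hhigh ?_ ?_
  · intro N
    have hpos : (0 : ℝ) < (N : ℝ) + 1 := by positivity
    have h := Nat.ceil_lt_add_one (a := β * (N : ℝ)) (by positivity)
    have e : 1 - β - (1 - β) * (1 / ((N : ℝ) + 1)) = ((1 - β) * N) / ((N : ℝ) + 1) := by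
      field_simp; ring
    simp only [e]
    gcongr
    linarith
  · intro N
    have hpos : (0 : ℝ) < (N : ℝ) + 1 := by positivity
    have h := Nat.le_ceil (β * (N : ℝ))
    have e : 1 - β + β * (1 / ((N : ℝ) + 1)) = ((1 - β) * N + 1) / ((N : ℝ) + 1) := by
      field_simp; ring
    simp only [e]
    gcongr
    linarith
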